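/- arXiv:1806.11195 — 2 statements merged into one kernel-verified Lean document; each statement's English description precedes it below -/
import Mathlib

section
/- Let R be a commutative ring, n a natural number, A : Fin n → Matrix (Fin 2) (Fin 2) R a family of 2×2 matrices, and σ a permutation of Fin n. Then for all i, j ∈ Fin (2^n), the (i, j)-entry of the iterated Kronecker product of the permuted family A ∘ σ (i.e., A_{σ(n-1)} ⊗ ⋯ ⊗ A_{σ(0)}) equals the (π_σ(i), π_σ(j))-entry of the iterated Kronecker product of the original family A_{n-1} ⊗ ⋯ ⊗ A_0. In other words, permuting the layers of the factor graph by σ is equivalent to permuting the row and column bit indices by the digit permutation π_σ. -/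
/-- The `k`-th binary digit of the natural number `i`. -/
def bit (k i : ℕ) : ℕ := i / 2 ^ k % 2

/-- The digit permutation `π_σ` on `Fin (2 ^ n)` induced by a permutation `σ` of
`Fin n`: it sends `i` to the index `j` with `bit (σ k) j = bit k i` for all `k`. -/
def digitPerm (n : ℕ) (σ : Equiv.Perm (Fin n)) (i : Fin (2 ^ n)) : Fin (2 ^ n) :=
  ⟨(∑ k : Fin n, bit k i.val * 2 ^ (σ k : ℕ)) % 2 ^ n, Nat.mod_lt _ (by positivity)⟩

/-- The identification `Fin 2 × Fin (2 ^ n) ≃ Fin (2 ^ (n + 1))` sending `(a, b)`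
to the index whose top binary digit is `a` and whose lower `n` digits are `b`. -/
def pow2Equiv (n : ℕ) : Fin 2 × Fin (2 ^ n) ≃ Fin (2 ^ (n + 1)) :=
  finProdFinEquiv.trans (finCongr (by ring))

/-- The iterated Kronecker product `A (n-1) ⊗ A (n-2) ⊗ ⋯ ⊗ A 0`, defined layer
by layer, viewed as a `2 ^ n × 2 ^ n` matrix indexed by `Fin (2 ^ n)`. -/
def iterKron {R : Type*} [CommRing R] :
    (n : ℕ) → (Fin n → Matrix (Fin 2) (Fin 2) R) →
      Matrix (Fin (2 ^ n)) (Fin (2 ^ n)) R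
  | 0, _ => 1
  | n + 1, A =>
      Matrix.reindex (pow2Equiv n) (pow2Equiv n)
        (Matrix.kroneckerMap (· * ·) (A (Fin.last n)) (iterKron n (A ∘ Fin.castSucc)))

theorem bit_lt_two (k i : ℕ) : bit k i < 2 := Nat.mod_lt _ two_pos

theorem bit_add_mul_two_pow {k n : ℕ} (hk : k < n) (x a : ℕ) :
    bit k (x + a * 2 ^ n) = bit k x := by
  obtain ⟨d, rfl⟩ := Nat.exists_eq_add_of_lt hk
  have h : x + a * 2 ^ (k + d + 1) = x + 2 ^ k * (2 * (a * 2 ^ d)) := by ring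
  rw [bit, bit, h, Nat.add_mul_div_left _ _ (by positivity), Nat.add_mul_mod_self_left]

theorem bit_mod_two_pow {k n : ℕ} (hk : k < n) (i : ℕ) : bit k (i % 2 ^ n) = bit k i := by
  conv_rhs => rw [← Nat.mod_add_div' i (2 ^ n), bit_add_mul_two_pow hk]

theorem sum_mul_two_pow_lt {n : ℕ} (f : Fin n → ℕ) (hf : ∀ k, f k < 2) :
    ∑ k : Fin n, f k * 2 ^ (k : ℕ) < 2 ^ n := by
  induction n with
  | zero => simp
  | succ n ih =>
    rw [Fin.sum_univ_castSucc, pow_succ]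
    have h := ih (fun k => f k.castSucc) (fun k => hf _)
    have h' := Nat.mul_le_mul_right (2 ^ n) (Nat.le_of_lt_succ (hf (Fin.last n)))
    simp only [Fin.val_castSucc, Fin.val_last] at *
    lia

theorem bit_sum_mul_two_pow {n : ℕ} (f : Fin n → ℕ) (hf : ∀ k, f k < 2) (m : Fin n) :
    bit m (∑ k : Fin n, f k * 2 ^ (k : ℕ)) = f m := by
  induction n with
  | zero => exact m.elim0
  | succ n ih =>
    rw [Fin.sum_univ_castSucc]
    simp only [Fin.val_castSucc, Fin.val_last]
    cases m using Fin.lastCases with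
    | last =>
      rw [bit, Fin.val_last, Nat.add_mul_div_right _ _ (by positivity),
        Nat.div_eq_of_lt (sum_mul_two_pow_lt (fun k => f k.castSucc) fun k => hf _), zero_add,
        Nat.mod_eq_of_lt (hf _)]
    | cast m =>
      rw [Fin.val_castSucc, bit_add_mul_two_pow m.isLt]
      exact ih (fun k => f k.castSucc) (fun k => hf _) m

theorem bit_digitPerm {n : ℕ} (σ : Equiv.Perm (Fin n)) (i : Fin (2 ^ n)) (k : Fin n) :
    bit (σ k) (digitPerm n σ i) = bit k i := by
  have h : ∑ k : Fin n, bit k i * 2 ^ (σ k : ℕ) =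
      ∑ k : Fin n, bit (σ.symm k : Fin n) i * 2 ^ (k : ℕ) := by
    rw [← Equiv.sum_comp σ fun k => bit (σ.symm k : Fin n) i * 2 ^ (k : ℕ)]
    simp
  rw [digitPerm, bit_mod_two_pow (σ k).isLt, h,
    bit_sum_mul_two_pow (fun k => bit (σ.symm k : Fin n) i) (fun _ => bit_lt_two _ _),
    Equiv.symm_apply_apply]

theorem iterKron_apply {R : Type*} [CommRing R] (n : ℕ)
    (A : Fin n → Matrix (Fin 2) (Fin 2) R) (i j : Fin (2 ^ n)) :
    iterKron n A i j =
      ∏ k : Fin n, A k ⟨bit k i, bit_lt_two _ _⟩ ⟨bit k j, bit_lt_two _ _⟩ := by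
  induction n with
  | zero =>
    obtain rfl : i = j := Subsingleton.elim (α := Fin 1) i j
    simp [iterKron]
  | succ n ih =>
    have top (x : Fin (2 ^ (n + 1))) :
        ((pow2Equiv n).symm x).1 = ⟨bit n x, bit_lt_two _ _⟩ := by
      have hx : x.val / 2 ^ n < 2 := Nat.div_lt_of_lt_mul (by rw [← pow_succ]; exact x.isLt)
      ext
      simp [pow2Equiv, finProdFinEquiv, bit, Nat.mod_eq_of_lt hx]
    have low (x : Fin (2 ^ (n + 1))) : (((pow2Equiv n).symm x).2 : ℕ) = x % 2 ^ n := by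
      simp [pow2Equiv, finProdFinEquiv]
    rw [Fin.prod_univ_castSucc, mul_comm]
    simp only [iterKron, Matrix.reindex_apply, Matrix.submatrix_apply,
      Matrix.kroneckerMap_apply, top, ih, low, Function.comp_apply, Fin.val_last,
      Fin.val_castSucc, bit_mod_two_pow (Fin.isLt _)]

/-- Permuting the layers of the factor graph by `σ` is equivalent to permuting
the row and column bit indices by the digit permutation `π_σ`: the `(i, j)`-entry
of the iterated Kronecker product of the permuted family `A ∘ σ` equals the
`(π_σ i, π_σ j)`-entry of the iterated Kronecker product of `A`. -/
theorem iterKron_perm {R : Type*} [CommRing R] (n : ℕ)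
    (A : Fin n → Matrix (Fin 2) (Fin 2) R) (σ : Equiv.Perm (Fin n))
    (i j : Fin (2 ^ n)) :
    iterKron n (A ∘ σ) i j = iterKron n A (digitPerm n σ i) (digitPerm n σ j) := by
  rw [iterKron_apply, iterKron_apply,
    ← Equiv.prod_comp σ fun k => A k ⟨bit k (digitPerm n σ i), _⟩ ⟨bit k (digitPerm n σ j), _⟩]
  simp only [Function.comp_apply, bit_digitPerm]
end

section
/- Let n be a natural number and G the 2×2 matrix [[1,0],[1,1]] over ZMod 2. For all i, j ∈ Fin (2^n), the (i, j)-entry of the n-th Kronecker power G^{⊗n} equals 1 if every binary digit of j is less than or equal to the corresponding binary digit of i (i.e., b_k(j) ≤ b_k(i) for all k < n), and equals 0 otherwise. -/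
theorem val_pow2Equiv (n : ℕ) (a : Fin 2) (b : Fin (2 ^ n)) :
    (pow2Equiv n (a, b)).val = b.val + 2 ^ n * a.val := by
  simp [pow2Equiv]

theorem bit_add_two_pow_mul_of_lt {k n : ℕ} (hk : k < n) (a b : ℕ) :
    bit k (b + 2 ^ n * a) = bit k b := by
  obtain ⟨m, rfl⟩ := Nat.exists_eq_add_of_lt hk
  have h : b + 2 ^ (k + m + 1) * a = b + 2 ^ k * (2 * (2 ^ m * a)) := by ring
  rw [bit, bit, h, Nat.add_mul_div_left _ _ (by positivity), Nat.add_mul_mod_self_left]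

theorem bit_add_two_pow_mul_self {n a b : ℕ} (ha : a < 2) (hb : b < 2 ^ n) :
    bit n (b + 2 ^ n * a) = a := by
  rw [bit, Nat.add_mul_div_left _ _ (by positivity), Nat.div_eq_of_lt hb, zero_add,
    Nat.mod_eq_of_lt ha]

theorem iterKron_succ_apply {R : Type*} [CommRing R] (n : ℕ)
    (A : Fin (n + 1) → Matrix (Fin 2) (Fin 2) R) (a c : Fin 2) (b d : Fin (2 ^ n)) :
    iterKron (n + 1) A (pow2Equiv n (a, b)) (pow2Equiv n (c, d)) =
      A (Fin.last n) a c * iterKron n (A ∘ Fin.castSucc) b d := by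
  simp [iterKron]

theorem arikanKernel_apply (a c : Fin 2) :
    (!![1, 0; 1, 1] : Matrix (Fin 2) (Fin 2) (ZMod 2)) a c =
      if c.val ≤ a.val then 1 else 0 := by
  fin_cases a <;> fin_cases c <;> simp

/-- The `(i, j)`-entry of the `n`-th Kronecker power of Arıkan's kernel
`G = [[1,0],[1,1]]` over `GF(2)` equals `1` if every binary digit of `j` is at
most the corresponding binary digit of `i`, and `0` otherwise. -/
theorem kronPow_entry (n : ℕ) (i j : Fin (2 ^ n)) :
    iterKron n (fun _ => (!![1, 0; 1, 1] : Matrix (Fin 2) (Fin 2) (ZMod 2))) i j =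
      if ∀ k : Fin n, bit k j.val ≤ bit k i.val then 1 else 0 := by
  induction n with
  | zero =>
    obtain rfl : i = j := Fin.ext (by omega)
    simp [iterKron]
  | succ n ih =>
    obtain ⟨⟨a, b⟩, rfl⟩ := (pow2Equiv n).surjective i
    obtain ⟨⟨c, d⟩, rfl⟩ := (pow2Equiv n).surjective j
    have hdigits : (∀ k : Fin (n + 1), bit k (pow2Equiv n (c, d)).val ≤
        bit k (pow2Equiv n (a, b)).val) ↔
        c.val ≤ a.val ∧ ∀ k : Fin n, bit k d.val ≤ bit k b.val := by
      simp only [Fin.forall_fin_succ', val_pow2Equiv, Fin.val_castSucc, Fin.val_last,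
        bit_add_two_pow_mul_of_lt (Fin.is_lt _),
        bit_add_two_pow_mul_self (Fin.is_lt _) (Fin.is_lt _)]
      exact and_comm
    rw [iterKron_succ_apply, arikanKernel_apply, Function.comp_def, ih, if_congr hdigits rfl rfl,
      ite_and, ite_mul, one_mul, zero_mul]
end
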